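/- Let G be an internally 3-connected graph and let Ψ be a chord description of G. Then there is an S-restricted drawing of G in which every pair of edges that crosses is a crossing pair of Ψ. -/

import Mathlib

open scoped unitInterval

namespace OnePlanarity

/-- The six crossing types of a crossing in a 1-planar drawing. -/
inductive CrossingType : Type
  | full | almostFull | bowtie | arrow | chair | timesCross
  deriving DecidableEq

/-- The three crossing types in which the four endpoints of the crossing edges
lie on a common 4-cycle using the two crossing edges. -/
def goodTypes : Set CrossingType :=
  {CrossingType.full, CrossingType.almostFull, CrossingType.bowtie}

/-- The three "bad" crossing types. -/
def badTypes : Set CrossingType :=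
  {CrossingType.arrow, CrossingType.chair, CrossingType.timesCross}

variable {V : Type*} {W : Type*}

/-- `HasCrossingType G a b c d t` says that, assuming the edges `ab` and `cd` of `G`
cross, the subgraph of `G` induced by `{a,b,c,d}` witnesses the crossing type `t`. -/
def HasCrossingType (G : SimpleGraph V) (a b c d : V) : CrossingType → Prop
  | .full => G.Adj a c ∧ G.Adj a d ∧ G.Adj b c ∧ G.Adj b d
  | .almostFull =>
      (¬G.Adj a c ∧ G.Adj a d ∧ G.Adj b c ∧ G.Adj b d) ∨
      (G.Adj a c ∧ ¬G.Adj a d ∧ G.Adj b c ∧ G.Adj b d) ∨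
      (G.Adj a c ∧ G.Adj a d ∧ ¬G.Adj b c ∧ G.Adj b d) ∨
      (G.Adj a c ∧ G.Adj a d ∧ G.Adj b c ∧ ¬G.Adj b d)
  | .bowtie =>
      (G.Adj a c ∧ G.Adj b d ∧ ¬G.Adj a d ∧ ¬G.Adj b c) ∨
      (G.Adj a d ∧ G.Adj b c ∧ ¬G.Adj a c ∧ ¬G.Adj b d)
  | .arrow =>
      (G.Adj a c ∧ G.Adj a d ∧ ¬G.Adj b c ∧ ¬G.Adj b d) ∨
      (G.Adj b c ∧ G.Adj b d ∧ ¬G.Adj a c ∧ ¬G.Adj a d) ∨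
      (G.Adj a c ∧ G.Adj b c ∧ ¬G.Adj a d ∧ ¬G.Adj b d) ∨
      (G.Adj a d ∧ G.Adj b d ∧ ¬G.Adj a c ∧ ¬G.Adj b c)
  | .chair =>
      (G.Adj a c ∧ ¬G.Adj a d ∧ ¬G.Adj b c ∧ ¬G.Adj b d) ∨
      (¬G.Adj a c ∧ G.Adj a d ∧ ¬G.Adj b c ∧ ¬G.Adj b d) ∨
      (¬G.Adj a c ∧ ¬G.Adj a d ∧ G.Adj b c ∧ ¬G.Adj b d) ∨
      (¬G.Adj a c ∧ ¬G.Adj a d ∧ ¬G.Adj b c ∧ G.Adj b d)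
  | .timesCross => ¬G.Adj a c ∧ ¬G.Adj a d ∧ ¬G.Adj b c ∧ ¬G.Adj b d

/-- `IsArc A x y` says that `A` is the image of a simple curve from `x` to `y`. -/
def IsArc (A : Set (ℝ × ℝ)) (x y : ℝ × ℝ) : Prop :=
  ∃ f : I → ℝ × ℝ, Continuous f ∧ Function.Injective f ∧
    f 0 = x ∧ f 1 = y ∧ Set.range f = A

/-- A drawing of a graph `G` in the plane: vertices are mapped to distinct points,
every edge is mapped to a simple curve between the images of its endpoints avoiding the
images of all other vertices, and two edges intersect in finitely many points. -/
structure Drawing (G : SimpleGraph V) where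
  pos : V → ℝ × ℝ
  pos_inj : Function.Injective pos
  arc : Sym2 V → Set (ℝ × ℝ)
  arc_curve : ∀ e ∈ G.edgeSet, ∀ u v : V, e = s(u, v) → IsArc (arc e) (pos u) (pos v)
  arc_avoid : ∀ e ∈ G.edgeSet, ∀ w : V, pos w ∈ arc e → w ∈ e
  arc_finite_inter : ∀ e ∈ G.edgeSet, ∀ e' ∈ G.edgeSet, e ≠ e' →
    (arc e ∩ arc e').Finite

variable {G : SimpleGraph V}

/-- `D.Crosses e e' p` : the distinct edges `e` and `e'` of `G` cross at the point `p`
(an intersection point of their curves which is not the image of a vertex). -/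
def Drawing.Crosses (D : Drawing G) (e e' : Sym2 V) (p : ℝ × ℝ) : Prop :=
  e ∈ G.edgeSet ∧ e' ∈ G.edgeSet ∧ e ≠ e' ∧
    p ∈ D.arc e ∧ p ∈ D.arc e' ∧ p ∉ Set.range D.pos

/-- A drawing is 1-planar if every edge is involved in at most one crossing and
adjacent edges do not cross. -/
def Drawing.IsOnePlanar (D : Drawing G) : Prop :=
  (∀ e e₁ e₂ p q, D.Crosses e e₁ p → D.Crosses e e₂ q → e₁ = e₂ ∧ p = q) ∧
  (∀ e e' p, D.Crosses e e' p → ∀ v : V, v ∈ e → v ∉ e')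

/-- A drawing is `S`-restricted if it is 1-planar and every crossing has a type in `S`. -/
def Drawing.IsSRestricted (D : Drawing G) (S : Set CrossingType) : Prop :=
  D.IsOnePlanar ∧
  ∀ a b c d : V, ∀ p : ℝ × ℝ, D.Crosses s(a, b) s(c, d) p →
    ∃ t ∈ S, HasCrossingType G a b c d t

/-- A graph is 1-planar if it admits a 1-planar drawing. -/
def IsOnePlanarGraph (G : SimpleGraph V) : Prop :=
  ∃ D : Drawing G, D.IsOnePlanar

/-- A graph is `S`-restricted if it admits an `S`-restricted drawing. -/
def SRestricted (G : SimpleGraph V) (S : Set CrossingType) : Prop :=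
  ∃ D : Drawing G, D.IsSRestricted S

/-- A planar graph: one admitting a crossing-free drawing. -/
def IsPlanarGraph (G : SimpleGraph V) : Prop :=
  ∃ D : Drawing G, ∀ e e' p, ¬ D.Crosses e e' p

/-- A drawing is geometric if every edge is drawn as a straight-line segment. -/
def Drawing.IsGeometric (D : Drawing G) : Prop :=
  ∀ u v : V, G.Adj u v → D.arc s(u, v) = segment ℝ (D.pos u) (D.pos v)

/-- The point set of a drawing. -/
def Drawing.image (D : Drawing G) : Set (ℝ × ℝ) :=
  Set.range D.pos ∪ ⋃ e ∈ G.edgeSet, D.arc e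

/-- The set of points of the outer (unbounded) face of a point set `A`. -/
def outerRegion (A : Set (ℝ × ℝ)) : Set (ℝ × ℝ) :=
  {x | x ∉ A ∧ ¬ Bornology.IsBounded (connectedComponentIn Aᶜ x)}

/-- `Inside γ x` : the point `x` is separated from the outer face by the closed curve `γ`. -/
def Inside (γ : Set (ℝ × ℝ)) (x : ℝ × ℝ) : Prop :=
  x ∉ γ ∧ Bornology.IsBounded (connectedComponentIn γᶜ x)

/-- A vertex lies on (the boundary of) the outer face of a drawing. -/
def Drawing.OnOuterFace (D : Drawing G) (v : V) : Prop :=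
  D.pos v ∈ closure (outerRegion D.image)

/-- Two vertices are cofacial: they lie on the boundary of a common face. -/
def Drawing.Cofacial (D : Drawing G) (u v : V) : Prop :=
  ∃ p : ℝ × ℝ, p ∉ D.image ∧
    D.pos u ∈ closure (connectedComponentIn D.imageᶜ p) ∧
    D.pos v ∈ closure (connectedComponentIn D.imageᶜ p)

/-- A graph admits a geometric `S`-restricted drawing. -/
def GeoSRestricted (G : SimpleGraph V) (S : Set CrossingType) : Prop :=
  ∃ D : Drawing G, D.IsGeometric ∧ D.IsSRestricted S

/-- `OGeoSRestricted G S O` : the graph `G` admits a geometric `S`-restricted drawing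
in which the vertex of `O` (if any) lies on the outer face. -/
def OGeoSRestricted (G : SimpleGraph V) (S : Set CrossingType) (O : Set V) : Prop :=
  ∃ D : Drawing G, D.IsGeometric ∧ D.IsSRestricted S ∧ ∀ v ∈ O, D.OnOuterFace v

/-- `k`-connectivity. -/
def KConnected (k : ℕ) (G : SimpleGraph V) : Prop :=
  k < Nat.card V ∧ ∀ T : Set V, T.ncard < k → (G.induce Tᶜ).Connected

/-- A vertex has degree exactly two. -/
def DegTwo (G : SimpleGraph V) (w : V) : Prop :=
  ∃ a b : V, a ≠ b ∧ G.neighborSet w = {a, b}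

/-- The simple graph obtained from `G` by suppressing the degree-2 vertices in `W`. -/
def suppress (G : SimpleGraph V) (Ws : Set V) : SimpleGraph {v : V // v ∉ Ws} :=
  SimpleGraph.fromRel (fun a b =>
    G.Adj a.1 b.1 ∨ ∃ w ∈ Ws, G.Adj w a.1 ∧ G.Adj w b.1)

/-- A graph is internally 3-connected if it is obtained from a 3-connected (multi)graph by
subdividing a subset of its edges once each. -/
def InternallyThreeConnected (G : SimpleGraph V) : Prop :=
  ∃ Ws : Set V, (∀ w ∈ Ws, DegTwo G w) ∧ (∀ w ∈ Ws, ∀ u ∈ Ws, ¬ G.Adj w u) ∧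
    KConnected 3 (suppress G Ws)

/-- `IsSeparation G T X₁ X₂` : `(X₁, X₂)` is a separation of `G` induced by the separator `T`. -/
def IsSeparation (G : SimpleGraph V) (T X₁ X₂ : Set V) : Prop :=
  X₁ ∪ X₂ = Set.univ ∧ X₁ ∩ X₂ = T ∧ (X₁ \ T).Nonempty ∧ (X₂ \ T).Nonempty ∧
  ∀ u ∈ X₁ \ T, ∀ v ∈ X₂ \ T, ∀ p : G.Walk u v, ∃ w ∈ T, w ∈ p.support

end OnePlanarity
namespace OnePlanarity

variable {V : Type*}

/-- A graph is chordal if every cycle of length at least 4 has a chord. -/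
def IsChordal (G : SimpleGraph V) : Prop :=
  ∀ (v : V) (c : G.Walk v v), c.IsCycle → 4 ≤ c.length →
    ∃ a b : V, a ∈ c.support ∧ b ∈ c.support ∧ G.Adj a b ∧ s(a, b) ∉ c.edges

/-- `(e, g)` is a chord-tied pair (w.r.t. a chordal completion `Ĝ` of `G` and the set `S`
of admissible crossing types): `e = ab` is the crossing edge of a 4-cycle `a b c d` of `G`
whose vertices induce a crossing type from `S` in which `ab` and `cd` cross, and `g` is a
chord of this 4-cycle in `Ĝ`. -/
def IsChordTiedPair (G Ghat : SimpleGraph V) (S : Set CrossingType) (e g : Sym2 V) : Prop :=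
  ∃ a b c d : V, e = s(a, b) ∧
    G.Adj a b ∧ G.Adj b c ∧ G.Adj c d ∧ G.Adj d a ∧
    (∃ t ∈ S, HasCrossingType G a b c d t) ∧
    g ∈ Ghat.edgeSet ∧ (∀ x ∈ g, x ∈ ({a, b, c, d} : Set V)) ∧
    g ∉ ({s(a, b), s(b, c), s(c, d), s(d, a)} : Set (Sym2 V))

/-- `{e, e'}` is a crossing pair of the set `Ψ` of flagged chord-tied pairs: `e ≠ e'` and
`e` and `e'` are crossing edges of chord-tied pairs in `Ψ` with the same chord edge and
the same flag. -/
def CrossingPairOf (Ψ : Set (Sym2 V × Sym2 V × Bool)) (e e' : Sym2 V) : Prop :=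
  e ≠ e' ∧ ∃ (g : Sym2 V) (b : Bool), (e, g, b) ∈ Ψ ∧ (e', g, b) ∈ Ψ

/-- The graph obtained from `G` by replacing each pair of edges in `CP` by a 4-claw on
their endpoints (with a new centre vertex `Sum.inr P` for each pair `P ∈ CP`). -/
def planarizationBy (G : SimpleGraph V) (CP : Set (Sym2 (Sym2 V))) :
    SimpleGraph (V ⊕ Sym2 (Sym2 V)) :=
  SimpleGraph.fromRel (fun x y =>
    (∃ u w : V, x = Sum.inl u ∧ y = Sum.inl w ∧ G.Adj u w ∧ ∀ P ∈ CP, s(u, w) ∉ P) ∨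
    (∃ (u : V) (P : Sym2 (Sym2 V)), x = Sum.inl u ∧ y = Sum.inr P ∧ P ∈ CP ∧
      ∃ e ∈ P, u ∈ e))

/-- The crossing pairs of `Ψ`, as elements of `Sym2 (Sym2 V)`. -/
def crossingPairsOf (Ψ : Set (Sym2 V × Sym2 V × Bool)) : Set (Sym2 (Sym2 V)) :=
  {P | ∃ e e', CrossingPairOf Ψ e e' ∧ P = s(e, e')}

/-- A chord description of `G` (w.r.t. a chordal completion `Ĝ` and crossing types `S`):
a set `Ψ` of flagged chord-tied pairs `(e, g, b)` such that (1) every chord-tied pair in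
`Ψ` has exactly one partner in `Ψ` with the same chord edge and flag, (2) every edge is
the crossing edge of at most one chord-tied pair in `Ψ`, (3) replacing every crossing pair
of `Ψ` by a 4-claw yields a planar graph, and (4) the endpoints of every crossing pair of
`Ψ` induce a crossing type from `S` in which its two edges cross. -/
def IsChordDescription (G Ghat : SimpleGraph V) (S : Set CrossingType)
    (Ψ : Set (Sym2 V × Sym2 V × Bool)) : Prop :=
  (∀ ψ ∈ Ψ, IsChordTiedPair G Ghat S ψ.1 ψ.2.1) ∧
  (∀ ψ ∈ Ψ, ∃! e' : Sym2 V, e' ≠ ψ.1 ∧ (e', ψ.2.1, ψ.2.2) ∈ Ψ) ∧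
  (∀ (e g g' : Sym2 V) (b b' : Bool), (e, g, b) ∈ Ψ → (e, g', b') ∈ Ψ → g = g' ∧ b = b') ∧
  IsPlanarGraph (planarizationBy G (crossingPairsOf Ψ)) ∧
  (∀ e e', CrossingPairOf Ψ e e' →
    ∃ a b c d : V, e = s(a, b) ∧ e' = s(c, d) ∧ ∃ t ∈ S, HasCrossingType G a b c d t)

end OnePlanarity
namespace OnePlanarity

section Arcs

open Set

variable {A B : Set (ℝ × ℝ)} {x y z : ℝ × ℝ}

theorem isArc_iff : IsArc A x y ↔ ∃ F : ℝ → ℝ × ℝ, Continuous F ∧ InjOn F (Icc 0 1) ∧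
    F 0 = x ∧ F 1 = y ∧ F '' Icc 0 1 = A := by
  constructor
  · rintro ⟨f, hf, hinj, h0, h1, hr⟩
    refine ⟨IccExtend zero_le_one f, hf.Icc_extend', ?_, ?_, ?_, ?_⟩
    · intro s hs t ht h
      rw [IccExtend_of_mem _ _ hs, IccExtend_of_mem _ _ ht] at h
      simpa using hinj h
    · rw [IccExtend_of_mem _ _ (left_mem_Icc.2 zero_le_one)]; exact h0
    · rw [IccExtend_of_mem _ _ (right_mem_Icc.2 zero_le_one)]; exact h1
    · rw [← hr]
      ext p
      constructor
      · rintro ⟨t, ht, rfl⟩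
        exact ⟨⟨t, ht⟩, (IccExtend_of_mem _ _ ht).symm⟩
      · rintro ⟨t, rfl⟩
        exact ⟨t, t.2, IccExtend_of_mem _ _ t.2⟩
  · rintro ⟨F, hF, hinj, h0, h1, hr⟩
    refine ⟨fun t => F t, hF.comp continuous_subtype_val, ?_, by simpa using h0,
      by simpa using h1, ?_⟩
    · intro s t h
      exact Subtype.ext (hinj s.2 t.2 h)
    · rw [← hr, image_eq_range]

theorem IsArc.of_Icc {F : ℝ → ℝ × ℝ} {s t : ℝ} (hst : s < t) (hF : Continuous F)
    (hinj : InjOn F (Icc s t)) : IsArc (F '' Icc s t) (F s) (F t) := by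
  have hpos : 0 < t - s := sub_pos.2 hst
  refine isArc_iff.2 ⟨fun r => F ((t - s) * r + s), by fun_prop, ?_, by simp, by simp, ?_⟩
  · intro p hp q hq h
    have := hinj (x₁ := (t - s) * p + s) (x₂ := (t - s) * q + s)
      ⟨by nlinarith [hp.1], by nlinarith [hp.2]⟩ ⟨by nlinarith [hq.1], by nlinarith [hq.2]⟩ h
    exact mul_left_cancel₀ hpos.ne' (add_right_cancel this)
  · have := image_image F (fun r => (t - s) * r + s) (Icc 0 1)
    rw [← this, image_affine_Icc' hpos]
    simp

theorem IsArc.symm (h : IsArc A x y) : IsArc A y x := by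
  obtain ⟨f, hf, hinj, h0, h1, hr⟩ := h
  refine ⟨f ∘ unitInterval.symm, hf.comp unitInterval.continuous_symm,
    hinj.comp unitInterval.symm_bijective.injective, by simpa using h1, by simpa using h0, ?_⟩
  rw [unitInterval.symm_bijective.surjective.range_comp, hr]

theorem IsArc.left_mem (h : IsArc A x y) : x ∈ A := by
  obtain ⟨f, -, -, h0, -, hr⟩ := h
  exact hr ▸ ⟨0, h0⟩

theorem IsArc.right_mem (h : IsArc A x y) : y ∈ A := h.symm.left_mem

theorem IsArc.isCompact (h : IsArc A x y) : IsCompact A := by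
  obtain ⟨f, hf, -, -, -, hr⟩ := h
  exact hr ▸ isCompact_range hf

theorem IsArc.image (h : IsArc A x y) (φ : (ℝ × ℝ) ≃ₜ (ℝ × ℝ)) :
    IsArc (φ '' A) (φ x) (φ y) := by
  obtain ⟨f, hf, hinj, h0, h1, hr⟩ := h
  refine ⟨φ ∘ f, φ.continuous.comp hf, φ.injective.comp hinj, by simp [h0], by simp [h1], ?_⟩
  rw [range_comp, hr]

theorem isArc_segment (h : x ≠ y) : IsArc (segment ℝ x y) x y := by
  have := IsArc.of_Icc (F := AffineMap.lineMap x y) zero_lt_one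
    (AffineMap.lineMap_continuous) ((AffineMap.lineMap_injective ℝ h).injOn)
  simpa [segment_eq_image_lineMap] using this

/-- Concatenation of two arcs that meet only in a common end. -/
theorem IsArc.trans (hA : IsArc A x y) (hB : IsArc B y z) (hAB : ∀ p ∈ A, p ∈ B → p = y) :
    IsArc (A ∪ B) x z := by
  obtain ⟨F, hF, hFi, rfl, hF1, rfl⟩ := isArc_iff.1 hA
  obtain ⟨G, hG, hGi, hG0, rfl, rfl⟩ := isArc_iff.1 hB
  let H : ℝ → ℝ × ℝ := fun t => if t ≤ 1 then F t else G (t - 1)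
  have hH : Continuous H := by
    refine Continuous.if_le hF (by fun_prop) continuous_id continuous_const ?_
    rintro t rfl
    simp [hF1, hG0]
  have hle : ∀ t, t ≤ 1 → H t = F t := fun t ht => if_pos ht
  have hge : ∀ t, 1 ≤ t → H t = G (t - 1) := by
    intro t ht
    rcases ht.eq_or_lt with rfl | ht
    · rw [hle _ le_rfl, hF1, sub_self, hG0]
    · exact if_neg ht.not_ge
  have hmix : ∀ s t, s ∈ Icc (0 : ℝ) 1 → t ∈ Icc (1 : ℝ) 2 → H s = H t → s = t := by
    intro s t hs ht h
    have ht' : t - 1 ∈ Icc (0 : ℝ) 1 := ⟨by linarith [ht.1], by linarith [ht.2]⟩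
    rw [hle s hs.2, hge t ht.1] at h
    have hy := hAB (F s) ⟨s, hs, rfl⟩ ⟨t - 1, ht', h.symm⟩
    have h1 : s = 1 := hFi hs (right_mem_Icc.2 zero_le_one) (hy.trans hF1.symm)
    have h2 : t - 1 = 0 := hGi ht' (left_mem_Icc.2 zero_le_one) (h.symm.trans (hy.trans hG0.symm))
    linarith
  have hinj : InjOn H (Icc 0 2) := by
    intro s hs t ht h
    rcases le_total s 1 with hs1 | hs1 <;> rcases le_total t 1 with ht1 | ht1
    · rw [hle s hs1, hle t ht1] at h
      exact hFi ⟨hs.1, hs1⟩ ⟨ht.1, ht1⟩ h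
    · exact hmix s t ⟨hs.1, hs1⟩ ⟨ht1, ht.2⟩ h
    · exact (hmix t s ⟨ht.1, ht1⟩ ⟨hs1, hs.2⟩ h.symm).symm
    · rw [hge s hs1, hge t ht1] at h
      have := hGi (x₁ := s - 1) (x₂ := t - 1) ⟨by linarith, by linarith [hs.2]⟩
        ⟨by linarith, by linarith [ht.2]⟩ h
      linarith
  have himg : H '' Icc 0 2 = F '' Icc 0 1 ∪ G '' Icc 0 1 := by
    rw [← Icc_union_Icc_eq_Icc (zero_le_one (α := ℝ)) one_le_two, image_union]
    congr 1
    · exact image_congr fun t ht => hle t ht.2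
    · rw [image_congr (g := fun t => G (t - 1)) fun t ht => hge t ht.1,
        ← image_image G (fun t => t - 1), image_sub_const_Icc]
      norm_num
  have := IsArc.of_Icc two_pos hH hinj
  rw [himg, hle 0 zero_le_one, hge 2 one_le_two] at this
  norm_num at this
  exact this

/-- An arc entering a closed ball has an initial part that ends at its first point in the ball. -/
theorem IsArc.exists_first_hit (h : IsArc A x y) {c : ℝ × ℝ} {R : ℝ}
    (hx : R < dist x c) (hy : dist y c ≤ R) :
    ∃ q B, B ⊆ A ∧ dist q c = R ∧ IsArc B x q ∧ ∀ p ∈ B, dist p c ≤ R → p = q := by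
  obtain ⟨F, hF, hFi, rfl, rfl, rfl⟩ := isArc_iff.1 h
  have hd : Continuous fun t => dist (F t) c := by fun_prop
  obtain ⟨t, ⟨ht, htR⟩, hmin⟩ := (isCompact_Icc.inter_right
    (isClosed_le hd continuous_const)).exists_isLeast (s := Icc 0 1 ∩ {t | dist (F t) c ≤ R})
    ⟨1, right_mem_Icc.2 zero_le_one, hy⟩
  have ht0 : 0 < t := by
    refine ht.1.lt_of_ne ?_
    rintro rfl
    exact hx.not_ge htR
  have hsub : Icc 0 t ⊆ Icc 0 1 := Icc_subset_Icc_right ht.2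
  have hdist : dist (F t) c = R := by
    obtain ⟨s, hs, hsR⟩ := intermediate_value_Icc' ht0.le hd.continuousOn ⟨htR, hx.le⟩
    have : t ≤ s := hmin ⟨hsub hs, hsR.le⟩
    rw [le_antisymm this hs.2]
    exact hsR
  refine ⟨F t, F '' Icc 0 t, image_mono hsub, hdist, IsArc.of_Icc ht0 hF (hFi.mono hsub), ?_⟩
  rintro _ ⟨s, hs, rfl⟩ hsR
  rw [le_antisymm hs.2 (hmin ⟨hsub hs, hsR⟩)]

theorem IsArc.isPreconnected_diff_left (h : IsArc A x y) : IsPreconnected (A \ {x}) := by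
  obtain ⟨F, hF, hFi, rfl, rfl, rfl⟩ := isArc_iff.1 h
  have : F '' Icc 0 1 \ {F 0} = F '' Ioc 0 1 := by
    rw [← image_singleton, ← hFi.image_sdiff_subset (by simp), Icc_sdiff_left]
  rw [this]
  exact isPreconnected_Ioc.image _ hF.continuousOn

theorem IsArc.exists_mem_ne_dist_lt (h : IsArc A x y) {R : ℝ} (hR : 0 < R) :
    ∃ p ∈ A, p ≠ x ∧ dist p x < R := by
  obtain ⟨F, hF, hFi, rfl, rfl, rfl⟩ := isArc_iff.1 h
  obtain ⟨δ, hδ, hFδ⟩ := Metric.continuous_iff.1 hF 0 R hR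
  have hm : min (δ / 2) 1 ∈ Icc (0 : ℝ) 1 := ⟨by positivity, min_le_right _ _⟩
  have hpos : 0 < min (δ / 2) 1 := by positivity
  refine ⟨F (min (δ / 2) 1), ⟨_, hm, rfl⟩, fun he => ?_, hFδ _ ?_⟩
  · exact hpos.ne' (hFi hm (left_mem_Icc.2 zero_le_one) he)
  · rw [Real.dist_0_eq_abs, abs_of_pos hpos]
    exact (min_le_left _ _).trans_lt (half_lt_self hδ)

end Arcs

section Moving

open Set Metric

variable {E : Type*} [NormedAddCommGroup E] [NormedSpace ℝ E] [CompleteSpace E]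

theorem exists_homeomorph_of_mem_ball {c y : E} {r : ℝ} (hy : y ∈ ball c r) :
    ∃ φ : E ≃ₜ E, φ c = y ∧ ∀ z ∉ ball c r, φ z = z := by
  have hr : 0 < r := pos_of_mem_ball hy
  have hlt : ‖y - c‖ / r < 1 := (div_lt_one hr).2 (by rwa [← dist_eq_norm])
  let k : ℝ → ℝ := fun s => max 0 (1 - s / r)
  have hk : ∀ s t, |k s - k t| ≤ |s - t| / r := by
    intro s t
    have := abs_max_sub_max_le_abs (1 - s / r) (1 - t / r) 0
    rw [max_comm _ 0, max_comm _ 0] at this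
    refine this.trans_eq ?_
    have hdiv : |s - t| / r = |(t - s) / r| := by rw [abs_div, abs_of_pos hr, abs_sub_comm]
    rw [hdiv]
    congr 1
    ring
  let f : E → E := fun z => z + k (dist z c) • (y - c)
  have hf : ApproximatesLinearOn f ((ContinuousLinearEquiv.refl ℝ E : E ≃L[ℝ] E) : E →L[ℝ] E)
      univ ⟨‖y - c‖ / r, by positivity⟩ := by
    intro a _ b _
    have : f a - f b - (a - b) = (k (dist a c) - k (dist b c)) • (y - c) := by
      simp only [f, sub_smul]
      abel
    change ‖f a - f b - (a - b)‖ ≤ ‖y - c‖ / r * ‖a - b‖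
    rw [this, norm_smul, Real.norm_eq_abs]
    have h1 : |k (dist a c) - k (dist b c)| ≤ ‖a - b‖ / r := by
      refine (hk _ _).trans ?_
      gcongr
      rw [← dist_eq_norm]
      exact abs_dist_sub_le _ _ _
    calc _ ≤ ‖a - b‖ / r * ‖y - c‖ := by gcongr
      _ = _ := by ring
  have hc : Subsingleton E ∨ (⟨‖y - c‖ / r, by positivity⟩ : NNReal) <
      ‖((ContinuousLinearEquiv.refl ℝ E).symm : E →L[ℝ] E)‖₊⁻¹ := by
    rcases subsingleton_or_nontrivial E with h | h
    · exact Or.inl h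
    · right
      have : ‖((ContinuousLinearEquiv.refl ℝ E).symm : E →L[ℝ] E)‖₊ = 1 :=
        NNReal.eq ContinuousLinearMap.norm_id
      rw [this, inv_one]
      exact hlt
  refine ⟨hf.toHomeomorph f hc, ?_, fun z hz => ?_⟩
  · change f c = y
    simp [f, k]
  · change f z = z
    have : k (dist z c) = 0 := by
      refine max_eq_left (sub_nonpos.2 ((one_le_div hr).2 ?_))
      simpa using hz
    simp [f, this]

/-- A connected open set is homogeneous under the homeomorphisms of the whole space that are
supported in it. -/
theorem exists_homeomorph_of_isPreconnected {U : Set E} (hU : IsOpen U) (hc : IsPreconnected U)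
    {x y : E} (hx : x ∈ U) (hy : y ∈ U) :
    ∃ φ : E ≃ₜ E, φ x = y ∧ ∀ z ∉ U, φ z = z := by
  refine hc.induction₂ (fun x y => ∃ φ : E ≃ₜ E, φ x = y ∧ ∀ z ∉ U, φ z = z) ?_ ?_ ?_ hx hy
  · intro x hx
    obtain ⟨r, hr, hrU⟩ := isOpen_iff.1 hU x hx
    filter_upwards [mem_nhdsWithin_of_mem_nhds (ball_mem_nhds x hr)] with y hy
    obtain ⟨φ, h1, h2⟩ := exists_homeomorph_of_mem_ball hy
    exact ⟨φ, h1, fun z hz => h2 z fun h => hz (hrU h)⟩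
  · rintro x y z - - - ⟨φ, h1, h2⟩ ⟨ψ, h3, h4⟩
    exact ⟨φ.trans ψ, by simp [h1, h3], fun z hz => by simp [h2 z hz, h4 z hz]⟩
  · rintro x y - - ⟨φ, h1, h2⟩
    refine ⟨φ.symm, by simp [← h1], fun z hz => ?_⟩
    rw [Homeomorph.symm_apply_eq, h2 z hz]

end Moving

section Contraction

open Set Metric

variable {W : Type*}

theorem Drawing.exists_mem_of_not_crosses {H : SimpleGraph W} {D : Drawing H}
    (hD : ∀ e e' p, ¬ D.Crosses e e' p) {e e' : Sym2 W} (he : e ∈ H.edgeSet)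
    (he' : e' ∈ H.edgeSet) (hne : e ≠ e') {p : ℝ × ℝ} (hp : p ∈ D.arc e) (hp' : p ∈ D.arc e') :
    ∃ w, w ∈ e ∧ w ∈ e' ∧ D.pos w = p := by
  by_contra hcon
  refine hD e e' p ⟨he, he', hne, hp, hp', ?_⟩
  rintro ⟨w, rfl⟩
  exact hcon ⟨w, D.arc_avoid e he w hp, D.arc_avoid e' he' w hp', rfl⟩

theorem Drawing.isCompact_arc {H : SimpleGraph W} (D : Drawing H) {e : Sym2 W}
    (he : e ∈ H.edgeSet) : IsCompact (D.arc e) := by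
  induction e with
  | _ a b => exact (D.arc_curve _ he a b rfl).isCompact

theorem isPlanarGraph_of_arcs [Finite W] {H : SimpleGraph W} (pos : W → ℝ × ℝ)
    (hpos : Function.Injective pos) (arc : Sym2 W → Set (ℝ × ℝ))
    (hcurve : ∀ e ∈ H.edgeSet, ∀ u v : W, e = s(u, v) → IsArc (arc e) (pos u) (pos v))
    (havoid : ∀ e ∈ H.edgeSet, ∀ w : W, pos w ∈ arc e → w ∈ e)
    (hinter : ∀ e ∈ H.edgeSet, ∀ e' ∈ H.edgeSet, e ≠ e' → arc e ∩ arc e' ⊆ range pos) :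
    IsPlanarGraph H :=
  ⟨⟨pos, hpos, arc, hcurve, havoid, fun e he e' he' hne =>
    (finite_range pos).subset (hinter e he e' he' hne)⟩,
    fun e e' _ ⟨he, he', hne, hp, hp', hr⟩ => hr (hinter e he e' he' hne ⟨hp, hp'⟩)⟩

theorem eq_center_of_mem_segment {E : Type*} [NormedAddCommGroup E] [NormedSpace ℝ E]
    {c q q' p : E} (hq : dist q c = dist q' c) (hne : q ≠ q') (hp : p ∈ segment ℝ q c)
    (hp' : p ∈ segment ℝ q' c) : p = c := by
  rw [segment_symm, segment_eq_image'] at hp hp'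
  obtain ⟨s, hs, rfl⟩ := hp
  obtain ⟨t, ht, h⟩ := hp'
  have h : t • (q' - c) = s • (q - c) := add_left_cancel h
  rw [dist_eq_norm, dist_eq_norm] at hq
  have hn := congrArg norm h
  rw [norm_smul, norm_smul, hq, Real.norm_of_nonneg hs.1, Real.norm_of_nonneg ht.1] at hn
  have hpos : ‖q' - c‖ ≠ 0 := by
    intro h0
    rw [h0] at hq
    exact hne (sub_left_injective ((norm_eq_zero.1 hq).trans (norm_eq_zero.1 h0).symm))
  obtain rfl := mul_right_cancel₀ hpos hn
  rcases eq_or_ne t 0 with rfl | h0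
  · simp
  · exact absurd (sub_left_injective (smul_right_injective E h0 h)).symm hne

/-- If `H'` is obtained from `H` by contracting the edge `uv` into `u`, leaving `v` isolated, and
possibly deleting edges, then planarity of `H` implies planarity of `H'`. -/
theorem IsPlanarGraph.contract [Finite W] {H H' : SimpleGraph W} {u v : W} (huv : H.Adj u v)
    (hH : IsPlanarGraph H)
    (hv : ∀ x, ¬ H'.Adj x v)
    (hadj : ∀ x y, H'.Adj x y → x ≠ u → y ≠ u → H.Adj x y)
    (hu : ∀ x, H'.Adj x u → H.Adj x u ∨ H.Adj x v) : IsPlanarGraph H' := by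
  classical
  obtain ⟨D, hD⟩ := hH
  have hne : u ≠ v := huv.ne
  have hcl : ∀ (s : Set W) (T : Set (Sym2 W)), T ⊆ H.edgeSet →
      IsClosed (D.pos '' s ∪ ⋃ e ∈ T, D.arc e) := fun s T hT =>
    (s.toFinite.image D.pos).isClosed.union
      (T.toFinite.isClosed_biUnion fun e he => (D.isCompact_arc (hT he)).isClosed)
  -- a ball around `u` that meets only what is incident with `u` or `v`
  let K₀ : Set (ℝ × ℝ) := D.pos '' {w | w ≠ u ∧ w ≠ v} ∪
    ⋃ e ∈ {e | e ∈ H.edgeSet ∧ u ∉ e ∧ v ∉ e}, D.arc e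
  have huK₀ : D.pos u ∉ K₀ := by
    rintro (⟨w, hw, h⟩ | h)
    · exact hw.1 (D.pos_inj h)
    · obtain ⟨e, ⟨he, h1, -⟩, h⟩ := mem_iUnion₂.1 h
      exact h1 (D.arc_avoid e he u h)
  obtain ⟨R, hR, hRK₀⟩ : ∃ R > 0, ∀ p ∈ K₀, R < dist p (D.pos u) := by
    obtain ⟨R, hR, h⟩ := isOpen_iff.1 (hcl _ _ fun e he => he.1).isOpen_compl _ huK₀
    refine ⟨R / 2, half_pos hR, fun p hp => ?_⟩
    by_contra! hle
    exact h (mem_ball.2 (hle.trans_lt (half_lt_self hR))) hp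
  -- a homeomorphism moving `v` along the edge `uv` into this ball
  let K : Set (ℝ × ℝ) := D.pos '' {w | w ≠ v} ∪
    ⋃ e ∈ {e | e ∈ H.edgeSet ∧ v ∉ e}, D.arc e
  have hKcl : IsClosed K := hcl _ _ fun e he => he.1
  have hA := D.arc_curve s(u, v) huv u v rfl
  have hAK : D.arc s(u, v) \ {D.pos u} ⊆ Kᶜ := by
    rintro p ⟨hp, hpu⟩ (⟨w, hw, rfl⟩ | h)
    · rcases Sym2.mem_iff.1 (D.arc_avoid _ huv w hp) with rfl | rfl
      · exact hpu rfl
      · exact hw rfl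
    · obtain ⟨e, ⟨he, h1⟩, h⟩ := mem_iUnion₂.1 h
      obtain ⟨w, hw, hw', rfl⟩ := Drawing.exists_mem_of_not_crosses hD (e := s(u, v)) huv he
        (by rintro rfl; exact h1 (Sym2.mem_mk_right u v)) hp h
      rcases Sym2.mem_iff.1 hw with rfl | rfl
      · exact hpu rfl
      · exact h1 hw'
  obtain ⟨x, hxA, hxu, hxR⟩ := hA.exists_mem_ne_dist_lt hR
  have hvA : D.pos v ∈ D.arc s(u, v) \ {D.pos u} :=
    ⟨hA.right_mem, fun h => hne (D.pos_inj h).symm⟩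
  obtain ⟨φ, hφv, hφ⟩ : ∃ φ : (ℝ × ℝ) ≃ₜ (ℝ × ℝ), φ (D.pos v) = x ∧ ∀ z ∈ K, φ z = z := by
    obtain ⟨φ, h1, h2⟩ := exists_homeomorph_of_isPreconnected
      (hKcl.isOpen_compl.connectedComponentIn (x := D.pos v)) isPreconnected_connectedComponentIn
      (mem_connectedComponentIn (hAK hvA))
      (hA.isPreconnected_diff_left.subset_connectedComponentIn hvA hAK ⟨hxA, hxu⟩)
    exact ⟨φ, h1, fun z hz => h2 z fun h => connectedComponentIn_subset _ _ h hz⟩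
  have hφpos : ∀ w, w ≠ v → φ (D.pos w) = D.pos w := fun w hw => hφ _ (Or.inl ⟨w, hw, rfl⟩)
  have hfar : ∀ w, w ≠ u → w ≠ v → R < dist (D.pos w) (D.pos u) := fun w h1 h2 =>
    hRK₀ _ (Or.inl ⟨w, ⟨h1, h2⟩, rfl⟩)
  -- the new arcs
  have key : ∀ e' ∈ H'.edgeSet, ∃ e ∈ H.edgeSet, ∃ B : Set (ℝ × ℝ),
      (∀ y z, e' = s(y, z) → IsArc B (D.pos y) (D.pos z)) ∧
      e' = e.map (fun z => if z = v then u else z) ∧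
      (∀ p ∈ B, R < dist p (D.pos u) → p ∈ φ '' D.arc e) ∧
      ((∀ p ∈ B, R < dist p (D.pos u)) ∨ u ∈ e' ∧ ∃ q ∈ φ '' D.arc e,
        dist q (D.pos u) = R ∧ ∀ p ∈ B, dist p (D.pos u) ≤ R → p ∈ segment ℝ q (D.pos u)) := by
    intro e' he'
    have hve' : v ∉ e' := by
      intro h
      obtain ⟨y, rfl⟩ := h
      exact hv y (H'.adj_symm he')
    by_cases hue' : u ∈ e'
    · obtain ⟨w, rfl⟩ := hue'
      have hwu : w ≠ u := (H'.ne_of_adj he').symm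
      have hwv : w ≠ v := by
        rintro rfl
        exact hve' (Sym2.mem_mk_right _ _)
      obtain ⟨u', hu', hwu'⟩ : ∃ u', (u' = u ∨ u' = v) ∧ H.Adj w u' := by
        rcases hu w (H'.adj_symm he') with h | h
        · exact ⟨u, Or.inl rfl, h⟩
        · exact ⟨v, Or.inr rfl, h⟩
      have hend : dist (φ (D.pos u')) (D.pos u) ≤ R := by
        rcases hu' with rfl | rfl
        · rw [hφpos _ hne, dist_self]; exact hR.le
        · rw [hφv]; exact hxR.le
      have harc := (D.arc_curve s(w, u') hwu' w u' rfl).image φ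
      rw [hφpos w hwv] at harc
      obtain ⟨q, A', hA', hq, hqarc, hfirst⟩ := harc.exists_first_hit (hfar w hwu hwv) hend
      have hqu : q ≠ D.pos u := by
        rintro rfl
        rw [dist_self] at hq
        exact hR.ne hq
      have hseg : ∀ p ∈ segment ℝ q (D.pos u), dist p (D.pos u) ≤ R := fun p hp =>
        (convex_closedBall (D.pos u) R).segment_subset (mem_closedBall.2 hq.le)
          (mem_closedBall_self hR.le) hp
      have hB := hqarc.trans (isArc_segment hqu) fun p hp hp' => hfirst p hp (hseg p hp')
      refine ⟨s(w, u'), hwu', A' ∪ segment ℝ q (D.pos u), fun y z hyz => ?_, ?_, ?_, Or.inr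
        ⟨Sym2.mem_mk_left _ _, q, hA' hqarc.right_mem, hq, ?_⟩⟩
      · rcases Sym2.eq_iff.1 hyz with ⟨rfl, rfl⟩ | ⟨rfl, rfl⟩
        · exact hB.symm
        · exact hB
      · rcases hu' with rfl | rfl <;> simp [hwv, hne, Sym2.eq_swap]
      · rintro p (hp | hp) hpR
        · exact hA' hp
        · exact absurd hpR (hseg p hp).not_gt
      · rintro p (hp | hp) hpR
        · exact hfirst p hp hpR ▸ left_mem_segment ℝ _ _
        · exact hp
    · have he : e' ∈ H.edgeSet := by
        induction e' with
        | _ y z =>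
          refine hadj y z he' ?_ ?_ <;> rintro rfl <;> exact hue' (by simp)
      have hsub : D.arc e' ⊆ K₀ := fun p hp => Or.inr (mem_iUnion₂.2 ⟨e', ⟨he, hue', hve'⟩, hp⟩)
      refine ⟨e', he, D.arc e', D.arc_curve e' he, ?_, fun p hp _ => ⟨p, hp, ?_⟩,
        Or.inl fun p hp => hRK₀ p (hsub hp)⟩
      · induction e' with
        | _ y z =>
          have hy : y ≠ v := by rintro rfl; exact hve' (by simp)
          have hz : z ≠ v := by rintro rfl; exact hve' (by simp)
          simp [hy, hz]
      · exact hφ p (Or.inr (mem_iUnion₂.2 ⟨e', ⟨he, hve'⟩, hp⟩))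
  choose! ε hε B hcurve hmap hout hin using key
  -- a point for the isolated vertex `v`
  obtain ⟨o, ho⟩ : ∃ o, o ∉ range D.pos ∪ ⋃ e ∈ H'.edgeSet, B e := by
    have : IsCompact (range D.pos ∪ ⋃ e ∈ H'.edgeSet, B e) :=
      (finite_range _).isCompact.union (H'.edgeSet.toFinite.isCompact_biUnion fun e he => by
        induction e with
        | _ y z => exact (hcurve _ he y z rfl).isCompact)
    exact (ne_univ_iff_exists_notMem _).1 this.ne_univ
  simp only [mem_union, mem_range, mem_iUnion, not_or, not_exists] at ho
  have hpos : ∀ w, w ≠ v → Function.update D.pos v o w = D.pos w := fun w hw =>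
    Function.update_of_ne hw _ _
  refine isPlanarGraph_of_arcs (Function.update D.pos v o) ?_ B ?_ ?_ ?_
  · intro y z h
    by_cases hy : y = v <;> by_cases hz : z = v
    · rw [hy, hz]
    · rw [hy, hpos z hz, Function.update_self] at h
      exact absurd h.symm (ho.1 z)
    · rw [hz, hpos y hy, Function.update_self] at h
      exact absurd h (ho.1 y)
    · rw [hpos y hy, hpos z hz] at h
      exact D.pos_inj h
  · rintro e he y z rfl
    rw [hpos y, hpos z]
    · exact hcurve _ he y z rfl
    · rintro rfl; exact hv _ he
    · rintro rfl; exact hv _ (H'.adj_symm he)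
  · intro e he w hw
    by_cases hwv : w = v
    · rw [hwv, Function.update_self] at hw
      exact absurd hw (ho.2 e he)
    rw [hpos w hwv] at hw
    by_cases hwu : w = u
    · subst hwu
      rcases hin e he with h | h
      · exact absurd (h _ hw) (by simpa using hR.le)
      · exact h.1
    · obtain ⟨p, hp, hpw⟩ := hout e he _ hw (hfar w hwu hwv)
      rw [← hφpos w hwv] at hpw
      have := D.arc_avoid _ (hε e he) w (φ.injective hpw ▸ hp)
      rw [hmap e he, Sym2.mem_map]
      exact ⟨w, this, if_neg hwv⟩
  · rintro e he e' he' hee p ⟨hp, hp'⟩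
    have hεne : ε e ≠ ε e' := fun h => hee (by rw [hmap e he, hmap e' he', h])
    have hcommon : ∀ p, p ∈ φ '' D.arc (ε e) → p ∈ φ '' D.arc (ε e') →
        p = x ∨ ∃ w ≠ v, p = D.pos w := by
      rintro _ ⟨p, hp, rfl⟩ ⟨p', hp', hpp⟩
      obtain rfl := φ.injective hpp
      obtain ⟨w, -, -, rfl⟩ :=
        Drawing.exists_mem_of_not_crosses hD (hε e he) (hε e' he') hεne hp hp'
      by_cases hwv : w = v
      · left; rw [hwv, hφv]
      · exact Or.inr ⟨w, hwv, hφpos w hwv⟩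
    by_cases hpR : R < dist p (D.pos u)
    · rcases hcommon p (hout e he p hp hpR) (hout e' he' p hp' hpR) with rfl | ⟨w, hw, rfl⟩
      · exact absurd hpR hxR.not_gt
      · exact ⟨w, hpos w hw⟩
    · rcases hin e he with h | ⟨-, q, hq, hqR, hqs⟩
      · exact absurd (h p hp) hpR
      rcases hin e' he' with h | ⟨-, q', hq', hqR', hqs'⟩
      · exact absurd (h p hp') hpR
      refine ⟨u, ?_⟩
      rw [hpos u hne]
      refine (eq_center_of_mem_segment (hqR.trans hqR'.symm) ?_ (hqs p hp (not_lt.1 hpR))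
        (hqs' p hp' (not_lt.1 hpR))).symm
      rintro rfl
      rcases hcommon q hq hq' with rfl | ⟨w, hw, rfl⟩
      · exact hxR.ne hqR
      · by_cases hwu : w = u
        · rw [hwu, dist_self] at hqR
          exact hR.ne hqR
        · exact (hfar w hwu hw).ne' hqR

end Contraction

section Planarization

open Set

variable {V : Type*} {G : SimpleGraph V} {X : Set (Sym2 (Sym2 V))}

theorem planarizationBy_adj_inl_inl {x y : V} :
    (planarizationBy G X).Adj (Sum.inl x) (Sum.inl y) ↔ G.Adj x y ∧ ∀ P ∈ X, s(x, y) ∉ P := by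
  simp only [planarizationBy, SimpleGraph.fromRel_adj]
  constructor
  · rintro ⟨-, (⟨u, w, hu, hw, h⟩ | ⟨_, _, -, h, -⟩) | (⟨u, w, hu, hw, h⟩ | ⟨_, _, -, h, -⟩)⟩
    · cases hu; cases hw; exact h
    · cases h
    · cases hu; cases hw; rw [Sym2.eq_swap]; exact ⟨h.1.symm, h.2⟩
    · cases h
  · exact fun h => ⟨fun he => h.1.ne (Sum.inl_injective he), Or.inl (Or.inl ⟨x, y, rfl, rfl, h⟩)⟩

theorem planarizationBy_adj_inl_inr {x : V} {P : Sym2 (Sym2 V)} :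
    (planarizationBy G X).Adj (Sum.inl x) (Sum.inr P) ↔ P ∈ X ∧ ∃ e ∈ P, x ∈ e := by
  simp only [planarizationBy, SimpleGraph.fromRel_adj]
  constructor
  · rintro ⟨-, (⟨_, _, -, h, -⟩ | ⟨_, _, hu, hP, h⟩) | (⟨_, _, h, -, -⟩ | ⟨_, _, h, -, -⟩)⟩
    · cases h
    · cases hu; cases hP; exact h
    · cases h
    · cases h
  · exact fun h => ⟨Sum.inl_ne_inr, Or.inl (Or.inr ⟨x, P, rfl, rfl, h⟩)⟩

theorem not_planarizationBy_adj_inr_inr {P Q : Sym2 (Sym2 V)} :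
    ¬ (planarizationBy G X).Adj (Sum.inr P) (Sum.inr Q) := by
  simp [planarizationBy, SimpleGraph.fromRel_adj]

/-- A claw on a pair of adjacent edges can be contracted back into the two edges. -/
theorem isPlanarGraph_planarizationBy_diff_singleton [Finite V] {a b d : V}
    (hP : s(s(a, b), s(a, d)) ∈ X) (h : IsPlanarGraph (planarizationBy G X)) :
    IsPlanarGraph (planarizationBy G (X \ {s(s(a, b), s(a, d))})) := by
  refine h.contract (u := Sum.inl a) (v := Sum.inr s(s(a, b), s(a, d)))
    (planarizationBy_adj_inl_inr.2 ⟨hP, s(a, b), by simp, by simp⟩) ?_ ?_ ?_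
  · rintro (x | Q) hx
    · exact (planarizationBy_adj_inl_inr.1 hx).1.2 rfl
    · exact not_planarizationBy_adj_inr_inr hx
  · rintro (x | Q) (y | Q') hxy hx hy
    · rw [planarizationBy_adj_inl_inl] at hxy ⊢
      refine ⟨hxy.1, fun Q hQ hmem => ?_⟩
      by_cases hQP : Q = s(s(a, b), s(a, d))
      · have ha : a ∈ s(x, y) := by
          rw [hQP] at hmem
          rcases Sym2.mem_iff.1 hmem with h | h <;> rw [h] <;> exact Sym2.mem_mk_left _ _
        rcases Sym2.mem_iff.1 ha with rfl | rfl
        · exact hx rfl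
        · exact hy rfl
      · exact hxy.2 Q ⟨hQ, hQP⟩ hmem
    · rw [planarizationBy_adj_inl_inr] at hxy ⊢
      exact ⟨hxy.1.1, hxy.2⟩
    · replace hxy := hxy.symm
      refine SimpleGraph.Adj.symm ?_
      rw [planarizationBy_adj_inl_inr] at hxy ⊢
      exact ⟨hxy.1.1, hxy.2⟩
    · exact absurd hxy not_planarizationBy_adj_inr_inr
  · rintro (x | Q) hx
    · rw [planarizationBy_adj_inl_inl, planarizationBy_adj_inl_inr] at *
      by_cases hmem : s(x, a) ∈ s(s(a, b), s(a, d))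
      · exact Or.inr ⟨hP, _, hmem, Sym2.mem_mk_left _ _⟩
      · refine Or.inl ⟨hx.1, fun Q hQ hQx => ?_⟩
        by_cases hQP : Q = s(s(a, b), s(a, d))
        · exact hmem (hQP ▸ hQx)
        · exact hx.2 Q ⟨hQ, hQP⟩ hQx
    · replace hx := hx.symm
      refine Or.inl (SimpleGraph.Adj.symm ?_)
      rw [planarizationBy_adj_inl_inr] at hx ⊢
      exact ⟨hx.1.1, hx.2⟩

theorem isPlanarGraph_planarizationBy_diff [Finite V] {T : Set (Sym2 (Sym2 V))} (hTX : T ⊆ X)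
    (hT : ∀ P ∈ T, ∃ a b d, P = s(s(a, b), s(a, d))) (h : IsPlanarGraph (planarizationBy G X)) :
    IsPlanarGraph (planarizationBy G (X \ T)) := by
  induction T, T.toFinite using Set.Finite.induction_on with
  | empty => simpa using h
  | @insert P T hPT _ ih =>
    obtain ⟨a, b, d, rfl⟩ := hT P (mem_insert _ _)
    rw [← union_singleton, ← sdiff_sdiff]
    exact isPlanarGraph_planarizationBy_diff_singleton ⟨hTX (mem_insert _ _), hPT⟩
      (ih ((subset_insert _ _).trans hTX) fun Q hQ => hT Q (mem_insert_of_mem _ hQ))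

/-- If the pairs in `X` are pairwise disjoint and consist of nonadjacent edges, then a planar
drawing of the planarization yields a drawing of `G` whose crossings are the claw centres. -/
theorem exists_drawing_of_isPlanarGraph_planarizationBy [Finite V]
    (hunique : ∀ P ∈ X, ∀ Q ∈ X, ∀ e ∈ P, e ∈ Q → P = Q)
    (hdisj : ∀ P ∈ X, ∀ e ∈ P, ∀ e' ∈ P, e ≠ e' → ∀ v ∈ e, v ∉ e')
    (h : IsPlanarGraph (planarizationBy G X)) :
    ∃ (D : Drawing G) (c : Sym2 (Sym2 V) → ℝ × ℝ), ∀ e e' p, D.Crosses e e' p →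
      ∃ P ∈ X, e ∈ P ∧ e' ∈ P ∧ p = c P := by
  obtain ⟨D, hD⟩ := h
  let pieces : Sym2 V → Set (Sym2 (V ⊕ Sym2 (Sym2 V))) := fun e =>
    {f | (f = e.map Sum.inl ∧ ∀ P ∈ X, e ∉ P) ∨
      ∃ P ∈ X, e ∈ P ∧ ∃ x ∈ e, f = s(Sum.inl x, Sum.inr P)}
  let arc : Sym2 V → Set (ℝ × ℝ) := fun e => ⋃ f ∈ pieces e, D.arc f
  have hedge : ∀ e ∈ G.edgeSet, ∀ f ∈ pieces e, f ∈ (planarizationBy G X).edgeSet := by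
    rintro e he f (⟨rfl, hX⟩ | ⟨P, hP, heP, x, hx, rfl⟩)
    · induction e with
      | _ x y => exact planarizationBy_adj_inl_inl.2 ⟨he, hX⟩
    · exact planarizationBy_adj_inl_inr.2 ⟨hP, e, heP, hx⟩
  have hinl : ∀ e, ∀ f ∈ pieces e, ∀ w, Sum.inl w ∈ f → w ∈ e := by
    rintro e f (⟨rfl, -⟩ | ⟨P, -, -, x, hx, rfl⟩) w hw
    · obtain ⟨w', hw', h⟩ := Sym2.mem_map.1 hw
      exact Sum.inl_injective h ▸ hw'
    · rcases Sym2.mem_iff.1 hw with h | h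
      · exact Sum.inl_injective h ▸ hx
      · cases h
  have hinr : ∀ e, ∀ f ∈ pieces e, ∀ P, Sum.inr P ∈ f → P ∈ X ∧ e ∈ P := by
    rintro e f (⟨rfl, -⟩ | ⟨Q, hQ, heQ, x, hx, rfl⟩) P hP
    · obtain ⟨w, -, h⟩ := Sym2.mem_map.1 hP
      cases h
    · rcases Sym2.mem_iff.1 hP with h | h
      · cases h
      · exact Sum.inr_injective h ▸ ⟨hQ, heQ⟩
  have hpieces : ∀ e e', e ≠ e' → ∀ f ∈ pieces e, f ∉ pieces e' := by
    rintro e e' hne f (⟨rfl, -⟩ | ⟨P, hP, heP, x, hx, rfl⟩) hf'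
    · rcases hf' with ⟨h, -⟩ | ⟨P, -, -, x, -, h⟩
      · exact hne (Sym2.map.injective Sum.inl_injective h)
      · have : Sum.inr P ∈ e.map Sum.inl := h ▸ Sym2.mem_mk_right _ _
        obtain ⟨w, -, h⟩ := Sym2.mem_map.1 this
        cases h
    · exact hdisj P hP e heP e' (hinr e' _ hf' P (Sym2.mem_mk_right _ _)).2 hne x hx
        (hinl e' _ hf' x (Sym2.mem_mk_left _ _))
  have hmeet : ∀ e ∈ G.edgeSet, ∀ e' ∈ G.edgeSet, e ≠ e' → ∀ p ∈ arc e, p ∈ arc e' →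
      ∃ f ∈ pieces e, ∃ f' ∈ pieces e', ∃ w, w ∈ f ∧ w ∈ f' ∧ D.pos w = p := by
    intro e he e' he' hne p hp hp'
    obtain ⟨f, hf, hp⟩ := mem_iUnion₂.1 hp
    obtain ⟨f', hf', hp'⟩ := mem_iUnion₂.1 hp'
    exact ⟨f, hf, f', hf', Drawing.exists_mem_of_not_crosses hD (hedge e he f hf)
      (hedge e' he' f' hf') (fun h => hpieces e e' hne f hf (h ▸ hf')) hp hp'⟩
  refine ⟨⟨D.pos ∘ Sum.inl, D.pos_inj.comp Sum.inl_injective, arc, ?_, ?_, ?_⟩,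
    D.pos ∘ Sum.inr, ?_⟩
  · rintro e he u v rfl
    by_cases hX : ∃ P ∈ X, s(u, v) ∈ P
    · obtain ⟨P, hP, huv⟩ := hX
      have harc : arc s(u, v) = D.arc s(Sum.inl u, Sum.inr P) ∪ D.arc s(Sum.inr P, Sum.inl v) := by
        apply Subset.antisymm
        · refine iUnion₂_subset ?_
          rintro f (⟨-, h⟩ | ⟨Q, hQ, heQ, x, hx, rfl⟩)
          · exact absurd huv (h P hP)
          · obtain rfl := hunique P hP Q hQ _ huv heQ
            rcases Sym2.mem_iff.1 hx with rfl | rfl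
            · exact subset_union_left
            · rw [Sym2.eq_swap (a := Sum.inl x)]
              exact subset_union_right
        · refine union_subset (subset_biUnion_of_mem (u := D.arc) (Or.inr ?_))
            (subset_biUnion_of_mem (u := D.arc) (Or.inr ?_))
          · exact ⟨P, hP, huv, u, Sym2.mem_mk_left _ _, rfl⟩
          · exact ⟨P, hP, huv, v, Sym2.mem_mk_right _ _, Sym2.eq_swap⟩
      have hu : (planarizationBy G X).Adj (Sum.inl u) (Sum.inr P) :=
        planarizationBy_adj_inl_inr.2 ⟨hP, _, huv, Sym2.mem_mk_left _ _⟩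
      have hv : (planarizationBy G X).Adj (Sum.inr P) (Sum.inl v) :=
        (planarizationBy_adj_inl_inr.2 ⟨hP, _, huv, Sym2.mem_mk_right _ _⟩).symm
      have huv' : u ≠ v := G.ne_of_adj he
      rw [harc]
      refine (D.arc_curve _ hu _ _ rfl).trans (D.arc_curve _ hv _ _ rfl) fun p hp hp' => ?_
      obtain ⟨w, hw, hw', rfl⟩ := Drawing.exists_mem_of_not_crosses hD hu hv
        (by simp [huv']) hp hp'
      rcases Sym2.mem_iff.1 hw with rfl | rfl
      · simp [huv'] at hw'
      · rfl
    · push Not at hX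
      have harc : arc s(u, v) = D.arc s(Sum.inl u, Sum.inl v) := by
        apply Subset.antisymm
        · refine iUnion₂_subset ?_
          rintro f (⟨rfl, -⟩ | ⟨Q, hQ, heQ, -⟩)
          · exact Subset.rfl
          · exact absurd heQ (hX Q hQ)
        · exact subset_biUnion_of_mem (u := D.arc) (Or.inl ⟨rfl, hX⟩)
      rw [harc]
      exact D.arc_curve _ (planarizationBy_adj_inl_inl.2 ⟨he, hX⟩) _ _ rfl
  · intro e he w hw
    obtain ⟨f, hf, hw⟩ := mem_iUnion₂.1 hw
    exact hinl e f hf w (D.arc_avoid f (hedge e he f hf) _ hw)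
  · intro e he e' he' hne
    refine (finite_range D.pos).subset ?_
    rintro p ⟨hp, hp'⟩
    obtain ⟨-, -, -, -, w, -, -, rfl⟩ := hmeet e he e' he' hne p hp hp'
    exact mem_range_self w
  · rintro e e' p ⟨he, he', hne, hp, hp', hpos⟩
    obtain ⟨f, hf, f', hf', w, hw, hw', rfl⟩ := hmeet e he e' he' hne p hp hp'
    rcases w with w | P
    · exact absurd ⟨w, rfl⟩ hpos
    · obtain ⟨hP, heP⟩ := hinr e f hf P hw
      exact ⟨P, hP, heP, (hinr e' f' hf' P hw').2, rfl⟩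

end Planarization

section ChordDescription

variable {V : Type*} {G Ghat : SimpleGraph V} {S : Set CrossingType}
  {Ψ : Set (Sym2 V × Sym2 V × Bool)}

theorem HasCrossingType.swap_left {a b c d : V} {t : CrossingType} (ht : t ∈ goodTypes)
    (h : HasCrossingType G a b c d t) : HasCrossingType G b a c d t := by
  rcases ht with rfl | rfl | rfl <;> simp only [HasCrossingType] at h ⊢ <;> tauto

theorem HasCrossingType.swap_right {a b c d : V} {t : CrossingType} (ht : t ∈ goodTypes)
    (h : HasCrossingType G a b c d t) : HasCrossingType G a b d c t := by
  rcases ht with rfl | rfl | rfl <;> simp only [HasCrossingType] at h ⊢ <;> tauto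

theorem CrossingPairOf.symm {e e' : Sym2 V} (h : CrossingPairOf Ψ e e') :
    CrossingPairOf Ψ e' e :=
  ⟨h.1.symm, h.2.imp fun _ => Exists.imp fun _ hg => hg.symm⟩

theorem crossingPairOf_of_mem {P : Sym2 (Sym2 V)} (hP : P ∈ crossingPairsOf Ψ) {e : Sym2 V}
    (he : e ∈ P) : ∃ f, CrossingPairOf Ψ e f ∧ P = s(e, f) := by
  obtain ⟨e₁, e₂, h, rfl⟩ := hP
  rcases Sym2.mem_iff.1 he with rfl | rfl
  · exact ⟨e₂, h, rfl⟩
  · exact ⟨e₁, h.symm, Sym2.eq_swap⟩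

theorem crossingPairOf_of_mem_of_mem {P : Sym2 (Sym2 V)} (hP : P ∈ crossingPairsOf Ψ)
    {e e' : Sym2 V} (he : e ∈ P) (he' : e' ∈ P) (hne : e ≠ e') : CrossingPairOf Ψ e e' := by
  obtain ⟨f, hf, rfl⟩ := crossingPairOf_of_mem hP he
  rcases Sym2.mem_iff.1 he' with rfl | rfl
  · exact absurd rfl hne
  · exact hf

theorem IsChordDescription.eq_of_mem (hΨ : IsChordDescription G Ghat S Ψ)
    {P Q : Sym2 (Sym2 V)} (hP : P ∈ crossingPairsOf Ψ) (hQ : Q ∈ crossingPairsOf Ψ) {e : Sym2 V}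
    (heP : e ∈ P) (heQ : e ∈ Q) : P = Q := by
  obtain ⟨f, ⟨hf, g, b, he, hfg⟩, rfl⟩ := crossingPairOf_of_mem hP heP
  obtain ⟨f', ⟨hf', g', b', he', hfg'⟩, rfl⟩ := crossingPairOf_of_mem hQ heQ
  obtain ⟨rfl, rfl⟩ := hΨ.2.2.1 e g g' b b' he he'
  rw [(hΨ.2.1 _ he).unique ⟨hf.symm, hfg⟩ ⟨hf'.symm, hfg'⟩]

theorem IsChordDescription.hasCrossingType (hΨ : IsChordDescription G Ghat S Ψ)
    (hS : S ⊆ goodTypes) {a b c d : V} (h : CrossingPairOf Ψ s(a, b) s(c, d)) :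
    ∃ t ∈ S, HasCrossingType G a b c d t := by
  obtain ⟨a', b', c', d', hab, hcd, t, ht, htype⟩ := hΨ.2.2.2.2 _ _ h
  refine ⟨t, ht, ?_⟩
  rcases Sym2.eq_iff.1 hab with ⟨rfl, rfl⟩ | ⟨rfl, rfl⟩ <;>
    rcases Sym2.eq_iff.1 hcd with ⟨rfl, rfl⟩ | ⟨rfl, rfl⟩
  · exact htype
  · exact htype.swap_right (hS ht)
  · exact htype.swap_left (hS ht)
  · exact (htype.swap_left (hS ht)).swap_right (hS ht)

end ChordDescription

/-- **From a chord description to a drawing.** Let `S ⊆ {full, almost-full, bowtie}` be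
nonempty, `G` an internally 3-connected graph, `Ĝ` a chordal completion of `G`, and `Ψ` a
chord description of `G`.  Then there is an `S`-restricted drawing of `G` in which every
pair of crossing edges is a crossing pair of `Ψ`. -/
theorem chord_description_to_drawing {V : Type*} [Fintype V]
    (G Ghat : SimpleGraph V) (hsub : G ≤ Ghat) (hchordal : IsChordal Ghat)
    (S : Set CrossingType) (hS : S ⊆ goodTypes) (hne : S.Nonempty)
    (hi3c : InternallyThreeConnected G)
    (Ψ : Set (Sym2 V × Sym2 V × Bool)) (hΨ : IsChordDescription G Ghat S Ψ) :
    ∃ D : Drawing G, D.IsSRestricted S ∧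
      ∀ e e' p, D.Crosses e e' p → CrossingPairOf Ψ e e' := by
  let T : Set (Sym2 (Sym2 V)) :=
    {P | P ∈ crossingPairsOf Ψ ∧ ∃ a b d, P = s(s(a, b), s(a, d))}
  have hdisj : ∀ P ∈ crossingPairsOf Ψ \ T, ∀ e ∈ P, ∀ e' ∈ P, e ≠ e' → ∀ v ∈ e, v ∉ e' := by
    rintro P ⟨hP, hPT⟩ e he e' he' hne v ⟨b, rfl⟩ ⟨d, rfl⟩
    exact hPT ⟨hP, v, b, d, (Sym2.mem_and_mem_iff hne).1 ⟨he, he'⟩⟩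
  obtain ⟨D, c, hD⟩ := exists_drawing_of_isPlanarGraph_planarizationBy
    (fun P hP Q hQ e => hΨ.eq_of_mem hP.1 hQ.1) hdisj
    (isPlanarGraph_planarizationBy_diff (fun P hP => hP.1) (fun P hP => hP.2) hΨ.2.2.2.1)
  have hpair : ∀ e e' p, D.Crosses e e' p → CrossingPairOf Ψ e e' := by
    intro e e' p h
    obtain ⟨P, hP, he, he', -⟩ := hD e e' p h
    exact crossingPairOf_of_mem_of_mem hP.1 he he' h.2.2.1
  refine ⟨D, ⟨⟨fun e e₁ e₂ p q h₁ h₂ => ?_, fun e e' p h => ?_⟩, fun a b c d p h =>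
    hΨ.hasCrossingType hS (hpair _ _ _ h)⟩, hpair⟩
  · obtain ⟨P, hP, he, he₁, rfl⟩ := hD _ _ _ h₁
    obtain ⟨Q, hQ, he', he₂, rfl⟩ := hD _ _ _ h₂
    obtain rfl := hΨ.eq_of_mem hP.1 hQ.1 he he'
    rw [(Sym2.mem_and_mem_iff h₁.2.2.1).1 ⟨he, he₁⟩] at he₂
    exact ⟨((Sym2.mem_iff.1 he₂).resolve_left h₂.2.2.1.symm).symm, rfl⟩
  · obtain ⟨P, hP, he, he', -⟩ := hD _ _ _ h
    exact hdisj P hP e he e' he' h.2.2.1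

end OnePlanarity
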